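/- Let d ≥ 1, let q > 1 + d/2 and 1 ≤ r ≤ q be real numbers, and let a : ℝ^d → ℂ be a symbol of class S^r, A := a(D). Then there exists a constant C > 0 such that for every Schwartz vector field u = (u¹,…,u^d) : ℝ^d → ℝ^d and every Schwartz function w : ℝ^d → ℂ, ‖∇_u(Aw) − A(∇_u w)‖_{H^{q−r}} ≤ C ‖u‖_{H^q} ‖w‖_{H^q}, where ∇_u w := Σ_{j=1}^{d} u^j ∂_j w. (This is the boundedness of the first Gâteaux derivative A₁(u) = [∇_u, A] of the twisted inertia operator at the identity.) -/

import Mathlib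

open MeasureTheory Complex
open scoped FourierTransform BigOperators

noncomputable section

/-- Euclidean space `ℝ^d`. -/
abbrev Ed (d : ℕ) : Type := EuclideanSpace ℝ (Fin d)

/-- The Sobolev `H^s`-norm of a function on `ℝ^d`, defined via the Fourier transform:
`‖f‖_{H^s} = (∫ (1+‖ξ‖²)^s ‖𝓕f(ξ)‖² dξ)^{1/2}`. -/
noncomputable def HNorm {d : ℕ} (s : ℝ) (f : Ed d → ℂ) : ℝ :=
  (∫ ξ : Ed d, (1 + ‖ξ‖ ^ 2) ^ s * ‖𝓕 f ξ‖ ^ 2) ^ ((1 : ℝ) / 2)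

/-- A smooth function `a : ℝ^d → ℂ` is a symbol of class `S^r` if all its iterated
derivatives of order `n` are bounded by a constant times `(1+‖ξ‖²)^{(r-n)/2}`. -/
def IsSymbolS {d : ℕ} (r : ℝ) (a : Ed d → ℂ) : Prop :=
  ContDiff ℝ (⊤ : ℕ∞) a ∧
    ∀ n : ℕ, ∃ C > 0, ∀ ξ : Ed d,
      ‖iteratedFDeriv ℝ n a ξ‖ ≤ C * (1 + ‖ξ‖ ^ 2) ^ ((r - n) / 2)

/-- The Fourier multiplier with symbol `a`: `a(D)f = 𝓕⁻¹(a · 𝓕f)`. -/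
noncomputable def fm {d : ℕ} (a : Ed d → ℂ) (f : Ed d → ℂ) : Ed d → ℂ :=
  𝓕⁻ (fun ξ => a ξ * 𝓕 f ξ)

/-- The partial derivative `∂ⱼ h` of a function on `ℝ^d`. -/
noncomputable def pd {d : ℕ} (j : Fin d) (h : Ed d → ℂ) : Ed d → ℂ :=
  fun x => fderiv ℝ h x (EuclideanSpace.single j 1)

/-- The Sobolev `H^s`-norm of an `ℝ^d`-valued map, `‖u‖_{H^s}² = Σⱼ ‖uʲ‖_{H^s}²`. -/
noncomputable def HNormV {d : ℕ} (s : ℝ) (u : Ed d → Ed d) : ℝ :=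
  (∑ j : Fin d, HNorm s (fun x => ((u x j : ℝ) : ℂ)) ^ 2) ^ ((1 : ℝ) / 2)

/-- The Japanese bracket weight `⟨ξ⟩ˢ = (1+‖ξ‖²)^{s/2}`. -/
def jb {d : ℕ} (s : ℝ) (ξ : Ed d) : ℝ := (1 + ‖ξ‖ ^ 2) ^ (s / 2)

section Bracket

variable {d : ℕ}

lemma jb_pos (s : ℝ) (ξ : Ed d) : 0 < jb s ξ := by
  unfold jb; positivity

lemma jb_add (s t : ℝ) (ξ : Ed d) : jb (s + t) ξ = jb s ξ * jb t ξ := by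
  unfold jb
  rw [← Real.rpow_add (by positivity)]
  ring_nf

lemma jb_eq_rpow (s : ℝ) (ξ : Ed d) : jb s ξ = jb 1 ξ ^ s := by
  unfold jb
  rw [← Real.rpow_mul (by positivity)]
  ring_nf

lemma jb_one (ξ : Ed d) : jb 1 ξ = √(1 + ‖ξ‖ ^ 2) := by
  rw [jb, Real.sqrt_eq_rpow]

lemma norm_le_jb_one (ξ : Ed d) : ‖ξ‖ ≤ jb 1 ξ := by
  rw [jb_one]
  exact Real.le_sqrt_of_sq_le (by linarith)

lemma jb_one_mono {ξ η : Ed d} (h : ‖ξ‖ ≤ ‖η‖) : jb 1 ξ ≤ jb 1 η := by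
  rw [jb_one, jb_one]
  gcongr

lemma jb_one_le_add (ξ η : Ed d) : jb 1 ξ ≤ jb 1 (ξ - η) + jb 1 η := by
  have h1 := norm_le_jb_one η
  have h2 := norm_le_jb_one (ξ - η)
  have h3 : ‖ξ‖ ≤ ‖ξ - η‖ + ‖η‖ := by simpa using norm_add_le (ξ - η) η
  have e1 : jb 1 η ^ 2 = 1 + ‖η‖ ^ 2 := by rw [jb_one, Real.sq_sqrt (by positivity)]
  have e2 : jb 1 (ξ - η) ^ 2 = 1 + ‖ξ - η‖ ^ 2 := by rw [jb_one, Real.sq_sqrt (by positivity)]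
  rw [jb_one ξ]
  refine Real.sqrt_le_iff.2 ⟨(add_pos (jb_pos _ _) (jb_pos _ _)).le, ?_⟩
  have h4 : ‖ξ‖ ^ 2 ≤ (‖ξ - η‖ + ‖η‖) ^ 2 := by gcongr
  have h5 : ‖ξ - η‖ * ‖η‖ ≤ jb 1 (ξ - η) * jb 1 η := by
    gcongr
    exact (jb_pos _ _).le
  nlinarith

lemma continuous_jb (s : ℝ) : Continuous (jb s : Ed d → ℝ) := by
  unfold jb
  exact Continuous.rpow_const (by fun_prop) fun ξ => Or.inl (by positivity)

lemma hasTemperateGrowth_jb (s : ℝ) : (jb s : Ed d → ℝ).HasTemperateGrowth :=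
  Function.hasTemperateGrowth_one_add_norm_sq_rpow (Ed d) (s / 2)

end Bracket

lemma rpow_mul_add_rpow_le {X Y Z α β : ℝ} (hX : 0 < X) (hY : 0 < Y) (hZ : 0 < Z)
    (h : X ≤ Z + Y) (hα : 0 ≤ α) (hβ : 0 ≤ β) :
    X ^ α * (X ^ β + Y ^ β) ≤ 2 * 2 ^ (α + β) * (Z ^ (α + β) + Y ^ (α + β)) := by
  have hm : X ≤ 2 * max Z Y := by
    linarith [le_max_left Z Y, le_max_right Z Y]
  have hYm : Y ≤ 2 * max Z Y := by
    linarith [le_max_left Z Y, le_max_right Z Y]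
  have hm0 : 0 < max Z Y := lt_max_of_lt_left hZ
  calc X ^ α * (X ^ β + Y ^ β)
      ≤ (2 * max Z Y) ^ α * ((2 * max Z Y) ^ β + (2 * max Z Y) ^ β) := by gcongr
    _ = 2 * 2 ^ (α + β) * (max Z Y) ^ (α + β) := by
        rw [← two_mul, mul_left_comm, ← Real.rpow_add (by positivity),
          Real.mul_rpow (by norm_num) hm0.le]
        ring
    _ ≤ _ := by
        gcongr
        rcases max_choice Z Y with e | e <;> rw [e]
        · linarith [Real.rpow_nonneg hY.le (α + β)]
        · linarith [Real.rpow_nonneg hZ.le (α + β)]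

section Symbol

variable {d : ℕ} {r : ℝ} {a : Ed d → ℂ}

lemma IsSymbolS.hasTemperateGrowth (ha : IsSymbolS r a) : a.HasTemperateGrowth := by
  refine ⟨ha.1, fun n => ?_⟩
  obtain ⟨C, hC, h⟩ := ha.2 n
  obtain ⟨k, hk⟩ := exists_nat_ge (|r - n|)
  refine ⟨k, C, fun ξ => (h ξ).trans ?_⟩
  gcongr
  have h1 : jb (r - n) ξ ≤ (1 + ‖ξ‖) ^ k := by
    have hj : jb 1 ξ ≤ 1 + ‖ξ‖ := by rw [jb_one]; exact sqrt_one_add_norm_sq_le ξ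
    have hj1 : 1 ≤ jb 1 ξ := by
      rw [jb_one]; exact Real.one_le_sqrt.2 (by nlinarith [sq_nonneg ‖ξ‖])
    calc jb (r - n) ξ = jb 1 ξ ^ (r - n) := jb_eq_rpow _ _
      _ ≤ jb 1 ξ ^ (k : ℝ) := by
        gcongr
        exact (le_abs_self _).trans hk
      _ = jb 1 ξ ^ k := Real.rpow_natCast _ _
      _ ≤ _ := by gcongr
  exact h1

lemma IsSymbolS.norm_sub_le (ha : IsSymbolS r a) (hr : 1 ≤ r) :
    ∃ C > 0, ∀ ξ η : Ed d,
      ‖a η - a ξ‖ ≤ C * (jb 1 ξ ^ (r - 1) + jb 1 η ^ (r - 1)) * ‖ξ - η‖ := by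
  obtain ⟨C, hC, h⟩ := ha.2 1
  refine ⟨C, hC, fun ξ η => ?_⟩
  rw [norm_sub_rev ξ η]
  refine (convex_segment ξ η).norm_image_sub_le_of_norm_fderiv_le (𝕜 := ℝ) (f := a)
    (fun z _ => (ha.1.differentiable (by simp)) z) (fun z hz => ?_)
    (left_mem_segment ℝ ξ η) (right_mem_segment ℝ ξ η)
  have h1 := h z
  rw [norm_iteratedFDeriv_one] at h1
  refine h1.trans ?_
  gcongr
  have hz' : ‖z‖ ≤ max ‖ξ‖ ‖η‖ := (convexOn_norm convex_univ).le_max_of_mem_segment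
    (Set.mem_univ _) (Set.mem_univ _) hz
  have e : (1 + ‖z‖ ^ 2) ^ ((r - (1 : ℕ)) / 2) = jb 1 z ^ (r - 1) := by
    rw [← jb_eq_rpow, jb, Nat.cast_one]
  rw [e]
  have hξ := Real.rpow_nonneg (jb_pos 1 ξ).le (r - 1)
  have hη := Real.rpow_nonneg (jb_pos 1 η).le (r - 1)
  rcases le_max_iff.1 hz' with h' | h'
  · have := Real.rpow_le_rpow (jb_pos 1 z).le (jb_one_mono h') (sub_nonneg.2 hr)
    linarith
  · have := Real.rpow_le_rpow (jb_pos 1 z).le (jb_one_mono h') (sub_nonneg.2 hr)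
    linarith

/-- Pointwise bound for the kernel of the commutator of a multiplier and a derivative. -/
lemma IsSymbolS.kernel_bound (ha : IsSymbolS r a) (hr : 1 ≤ r) {q : ℝ} (hrq : r ≤ q) :
    ∃ C > 0, ∀ ξ η : Ed d, jb (q - r) ξ * (‖η‖ * ‖a η - a ξ‖) ≤
      C * (jb q (ξ - η) * jb 1 η + jb 1 (ξ - η) * jb q η) := by
  obtain ⟨C, hC, h⟩ := ha.norm_sub_le hr
  refine ⟨C * (2 * 2 ^ (q - 1)), by positivity, fun ξ η => ?_⟩
  have hX := jb_pos 1 ξ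
  have hY := jb_pos 1 η
  have hZ := jb_pos 1 (ξ - η)
  have key := rpow_mul_add_rpow_le hX hY hZ (jb_one_le_add ξ η) (sub_nonneg.2 hrq)
    (sub_nonneg.2 hr)
  have e : q - r + (r - 1) = q - 1 := by ring
  rw [e] at key
  have hs : ∀ z : Ed d, jb q z = jb 1 z ^ (q - 1) * jb 1 z := fun z => by
    rw [← jb_eq_rpow, ← jb_add, sub_add_cancel]
  calc jb (q - r) ξ * (‖η‖ * ‖a η - a ξ‖)
      ≤ jb 1 ξ ^ (q - r) * (jb 1 η *
          (C * (jb 1 ξ ^ (r - 1) + jb 1 η ^ (r - 1)) * jb 1 (ξ - η))) := by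
        rw [jb_eq_rpow (q - r)]
        gcongr
        · exact norm_le_jb_one η
        · refine (h ξ η).trans ?_
          gcongr
          exact norm_le_jb_one _
    _ = C * (jb 1 ξ ^ (q - r) * (jb 1 ξ ^ (r - 1) + jb 1 η ^ (r - 1))) *
          (jb 1 η * jb 1 (ξ - η)) := by ring
    _ ≤ C * (2 * 2 ^ (q - 1) * (jb 1 (ξ - η) ^ (q - 1) + jb 1 η ^ (q - 1))) *
          (jb 1 η * jb 1 (ξ - η)) := by gcongr
    _ = _ := by rw [hs, hs]; ring

end Symbol

section Young

open scoped ENNReal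

lemma sq_lintegral_mul_le {α : Type*} [MeasurableSpace α] {μ : Measure α} {f g : α → ℝ≥0∞}
    (hf : Measurable f) (hg : Measurable g) :
    (∫⁻ x, f x * g x ∂μ) ^ 2 ≤ (∫⁻ x, f x ∂μ) * ∫⁻ x, f x * g x ^ 2 ∂μ := by
  have h := ENNReal.lintegral_mul_le_Lp_mul_Lq μ Real.HolderConjugate.two_two
    (f := fun x => f x ^ (1 / 2 : ℝ)) (g := fun x => f x ^ (1 / 2 : ℝ) * g x)
    (by fun_prop) (by fun_prop)
  have hs : ∀ c : ℝ≥0∞, c ^ (1 / 2 : ℝ) * c ^ (1 / 2 : ℝ) = c := fun c => by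
    rw [← ENNReal.rpow_add_of_nonneg _ _ (by norm_num) (by norm_num)]; norm_num
  have e1 : ∀ x, f x ^ (1 / 2 : ℝ) * (f x ^ (1 / 2 : ℝ) * g x) = f x * g x := fun x => by
    rw [← mul_assoc, hs]
  have e2 : ∀ x, (f x ^ (1 / 2 : ℝ)) ^ (2 : ℝ) = f x := fun x => by
    rw [← ENNReal.rpow_mul]; norm_num
  have e3 : ∀ x, (f x ^ (1 / 2 : ℝ) * g x) ^ (2 : ℝ) = f x * g x ^ 2 := fun x => by
    rw [ENNReal.mul_rpow_of_nonneg _ _ (by norm_num), e2, ENNReal.rpow_two]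
  simp only [Pi.mul_apply, e1, e2, e3] at h
  calc _ ≤ _ := pow_le_pow_left' h 2
    _ = _ := by rw [mul_pow, sq, sq, hs, hs]

variable {G : Type*} [MeasurableSpace G] [AddCommGroup G] [MeasurableAdd₂ G] [MeasurableNeg G]
  {μ : Measure G} [SFinite μ] [μ.IsAddRightInvariant]

/-- Young's inequality `‖f ∗ g‖₂ ≤ ‖f‖₁ ‖g‖₂`, squared. -/
lemma lintegral_sq_convolution_le {f g : G → ℝ≥0∞} (hf : Measurable f) (hg : Measurable g) :
    ∫⁻ x, (∫⁻ y, f y * g (x - y) ∂μ) ^ 2 ∂μ ≤ (∫⁻ x, f x ∂μ) ^ 2 * ∫⁻ x, g x ^ 2 ∂μ := by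
  calc ∫⁻ x, (∫⁻ y, f y * g (x - y) ∂μ) ^ 2 ∂μ
      ≤ ∫⁻ x, (∫⁻ y, f y ∂μ) * ∫⁻ y, f y * g (x - y) ^ 2 ∂μ ∂μ :=
        lintegral_mono fun x => sq_lintegral_mul_le hf (by fun_prop)
    _ = (∫⁻ y, f y ∂μ) * ∫⁻ y, ∫⁻ x, f y * g (x - y) ^ 2 ∂μ ∂μ := by
        rw [lintegral_const_mul _ (by fun_prop), lintegral_lintegral_swap (by fun_prop)]
    _ = (∫⁻ y, f y ∂μ) * ∫⁻ y, f y * ∫⁻ x, g x ^ 2 ∂μ ∂μ := by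
        congr 1
        refine lintegral_congr fun y => ?_
        rw [lintegral_const_mul _ (by fun_prop),
          lintegral_sub_right_eq_self (fun x => g x ^ 2) y]
    _ = _ := by rw [lintegral_mul_const _ hf, sq, mul_assoc]

lemma lintegral_sq_convolution_le' [μ.IsAddLeftInvariant] [μ.IsNegInvariant] {f g : G → ℝ≥0∞} (hf : Measurable f) (hg : Measurable g) :
    ∫⁻ x, (∫⁻ y, f (x - y) * g y ∂μ) ^ 2 ∂μ ≤ (∫⁻ x, f x ∂μ) ^ 2 * ∫⁻ x, g x ^ 2 ∂μ := by
  refine le_trans (le_of_eq ?_) (lintegral_sq_convolution_le hf hg)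
  refine lintegral_congr fun x => ?_
  rw [← lintegral_sub_left_eq_self _ x]
  simp

lemma ENNReal.add_sq_le (x y : ℝ≥0∞) : (x + y) ^ 2 ≤ 4 * (x ^ 2 + y ^ 2) := by
  wlog h : x ≤ y generalizing x y
  · rw [add_comm x y, add_comm (x ^ 2)]
    exact this y x (le_of_not_ge h)
  calc (x + y) ^ 2 ≤ (y + y) ^ 2 := by gcongr
    _ = 4 * y ^ 2 := by ring
    _ ≤ _ := by gcongr; exact le_add_self

end Young

section WeightedConvolution

open scoped ENNReal

variable {d : ℕ}

lemma measurable_ofReal_jb (s : ℝ) : Measurable fun ξ : Ed d => ENNReal.ofReal (jb s ξ) :=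
  (continuous_jb s).measurable.ennreal_ofReal

lemma lintegral_jb_lt_top {s : ℝ} (hs : (d : ℝ) < s) :
    ∫⁻ ξ : Ed d, ENNReal.ofReal (jb (-s) ξ) < ∞ := by
  have h : Integrable (jb (-s) : Ed d → ℝ) :=
    integrable_rpow_neg_one_add_norm_sq (by simpa using hs)
  exact h.lintegral_lt_top

/-- The embedding of weighted `L²` into weighted `L¹`. -/
lemma exists_sq_lintegral_le {q : ℝ} (hq : 1 + (d : ℝ) / 2 < q) :
    ∃ M : ℝ≥0∞, M ≠ ∞ ∧ ∀ f : Ed d → ℝ≥0∞, Measurable f →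
      (∫⁻ ξ, ENNReal.ofReal (jb 1 ξ) * f ξ) ^ 2 ≤
        M * ∫⁻ ξ, (ENNReal.ofReal (jb q ξ) * f ξ) ^ 2 := by
  refine ⟨_, (lintegral_jb_lt_top (d := d) (s := 2 * q - 2) (by linarith)).ne, fun f hf => ?_⟩
  have hm := fun s => measurable_ofReal_jb (d := d) s
  have e : ∀ (s t : ℝ) (ξ : Ed d), ENNReal.ofReal (jb s ξ) * ENNReal.ofReal (jb t ξ) =
      ENNReal.ofReal (jb (s + t) ξ) := fun s t ξ => by
    rw [← ENNReal.ofReal_mul (jb_pos _ _).le, jb_add]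
  have h := sq_lintegral_mul_le (μ := volume) (hm (-(2 * q - 2)))
    ((hm (2 * q - 1)).mul hf)
  refine (le_of_eq ?_).trans (h.trans (le_of_eq ?_))
  · congr 1
    refine lintegral_congr fun ξ => ?_
    simp only [Pi.mul_apply]
    rw [← mul_assoc, e]
    ring_nf
  · congr 1
    refine lintegral_congr fun ξ => ?_
    simp only [Pi.mul_apply]
    rw [mul_pow, mul_pow, ← mul_assoc, sq (ENNReal.ofReal _), sq (ENNReal.ofReal _), e, e, e]
    ring_nf

lemma exists_lintegral_sq_weighted_convolution_le {q : ℝ} (hq : 1 + (d : ℝ) / 2 < q) :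
    ∃ M : ℝ≥0∞, M ≠ ∞ ∧ ∀ U W : Ed d → ℝ≥0∞, Measurable U → Measurable W →
      ∫⁻ ξ, (∫⁻ η, ENNReal.ofReal (jb q (ξ - η) * jb 1 η + jb 1 (ξ - η) * jb q η) *
          (U (ξ - η) * W η)) ^ 2 ≤
        M * ((∫⁻ ξ, (ENNReal.ofReal (jb q ξ) * U ξ) ^ 2) *
          ∫⁻ ξ, (ENNReal.ofReal (jb q ξ) * W ξ) ^ 2) := by
  obtain ⟨M, hM, h⟩ := exists_sq_lintegral_le hq
  refine ⟨8 * M, by finiteness, fun U W hU hW => ?_⟩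
  have hm := fun s => measurable_ofReal_jb (d := d) s
  set J : ℝ → Ed d → ℝ≥0∞ := fun s ξ => ENNReal.ofReal (jb s ξ) with hJ
  have hm : ∀ s, Measurable (J s) := hm
  have hq' := hm q
  have h1' := hm 1
  calc ∫⁻ ξ, (∫⁻ η, ENNReal.ofReal (jb q (ξ - η) * jb 1 η + jb 1 (ξ - η) * jb q η) *
          (U (ξ - η) * W η)) ^ 2
      = ∫⁻ ξ, ((∫⁻ η, (J 1 η * W η) * (J q (ξ - η) * U (ξ - η))) +
          ∫⁻ η, (J 1 (ξ - η) * U (ξ - η)) * (J q η * W η)) ^ 2 := by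
        refine lintegral_congr fun ξ => ?_
        rw [← lintegral_add_left (by fun_prop)]
        congr 1
        refine lintegral_congr fun η => ?_
        have p := fun s (z : Ed d) => (jb_pos s z).le
        rw [ENNReal.ofReal_add (mul_nonneg (p _ _) (p _ _)) (mul_nonneg (p _ _) (p _ _)),
          ENNReal.ofReal_mul (p _ _), ENNReal.ofReal_mul (p _ _)]
        simp only [hJ]
        ring
    _ ≤ ∫⁻ ξ, 4 * ((∫⁻ η, (J 1 η * W η) * (J q (ξ - η) * U (ξ - η))) ^ 2 +
          (∫⁻ η, (J 1 (ξ - η) * U (ξ - η)) * (J q η * W η)) ^ 2) :=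
        lintegral_mono fun ξ => ENNReal.add_sq_le _ _
    _ = 4 * ((∫⁻ ξ, (∫⁻ η, (J 1 η * W η) * (J q (ξ - η) * U (ξ - η))) ^ 2) +
          ∫⁻ ξ, (∫⁻ η, (J 1 (ξ - η) * U (ξ - η)) * (J q η * W η)) ^ 2) := by
        rw [lintegral_const_mul _ (by fun_prop), lintegral_add_left (by fun_prop)]
    _ ≤ 4 * ((∫⁻ ξ, J 1 ξ * W ξ) ^ 2 * (∫⁻ ξ, (J q ξ * U ξ) ^ 2) +
          (∫⁻ ξ, J 1 ξ * U ξ) ^ 2 * ∫⁻ ξ, (J q ξ * W ξ) ^ 2) := by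
        gcongr
        · exact lintegral_sq_convolution_le (f := fun η => J 1 η * W η)
            (g := fun η => J q η * U η) (by fun_prop) (by fun_prop)
        · exact lintegral_sq_convolution_le' (f := fun η => J 1 η * U η)
            (g := fun η => J q η * W η) (by fun_prop) (by fun_prop)
    _ ≤ 4 * ((M * ∫⁻ ξ, (J q ξ * W ξ) ^ 2) * (∫⁻ ξ, (J q ξ * U ξ) ^ 2) +
          (M * ∫⁻ ξ, (J q ξ * U ξ) ^ 2) * ∫⁻ ξ, (J q ξ * W ξ) ^ 2) := by
        gcongr
        · exact h W hW
        · exact h U hU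
    _ = _ := by ring

end WeightedConvolution

section Schwartz

open scoped ENNReal SchwartzMap LineDeriv

variable {d : ℕ}

lemma HNorm_nonneg (s : ℝ) (f : Ed d → ℂ) : 0 ≤ HNorm s f :=
  Real.rpow_nonneg (integral_nonneg fun ξ => by positivity) _

lemma ofReal_HNorm_sq (s : ℝ) (f : 𝓢(Ed d, ℂ)) :
    ENNReal.ofReal (HNorm s f ^ 2) =
      ∫⁻ ξ, (ENNReal.ofReal (jb s ξ) * ‖𝓕 (f : Ed d → ℂ) ξ‖ₑ) ^ 2 := by
  have hpt : ∀ ξ : Ed d, (1 + ‖ξ‖ ^ 2) ^ s * ‖𝓕 (f : Ed d → ℂ) ξ‖ ^ 2 =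
      ‖SchwartzMap.smulLeftCLM ℂ (jb s) (𝓕 f) ξ‖ ^ 2 := fun ξ => by
    rw [SchwartzMap.smulLeftCLM_apply_apply (hasTemperateGrowth_jb s), norm_smul,
      SchwartzMap.fourier_coe, mul_pow, Real.norm_of_nonneg (jb_pos _ _).le]
    congr 1
    rw [jb, ← Real.rpow_mul_natCast (by positivity)]
    norm_num
  have hint : Integrable fun ξ : Ed d => (1 + ‖ξ‖ ^ 2) ^ s * ‖𝓕 (f : Ed d → ℂ) ξ‖ ^ 2 := by
    simp_rw [hpt]
    exact ((SchwartzMap.memLp _ 2 volume).integrable_norm_pow (by norm_num))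
  rw [HNorm, ← Real.rpow_natCast, ← Real.rpow_mul (integral_nonneg fun ξ => by positivity)]
  norm_num
  rw [ofReal_integral_eq_lintegral_ofReal hint (.of_forall fun ξ => by positivity)]
  refine lintegral_congr fun ξ => ?_
  rw [hpt, ENNReal.ofReal_pow (norm_nonneg _),
    SchwartzMap.smulLeftCLM_apply_apply (hasTemperateGrowth_jb s), norm_smul,
    ENNReal.ofReal_mul (norm_nonneg _), Real.norm_of_nonneg (jb_pos _ _).le, ofReal_norm,
    SchwartzMap.fourier_coe]

/-- The Fourier transform takes products to convolutions. -/
lemma fourier_pairing_mul (f g : 𝓢(Ed d, ℂ)) (ξ : Ed d) :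
    𝓕 (SchwartzMap.pairing (ContinuousLinearMap.mul ℂ ℂ) f g) ξ =
      ∫ η, 𝓕 f η * 𝓕 g (ξ - η) := by
  have h : SchwartzMap.convolution (ContinuousLinearMap.mul ℂ ℂ) (𝓕 f) (𝓕 g) =
      𝓕 (SchwartzMap.pairing (ContinuousLinearMap.mul ℂ ℂ) f g) := by
    have hF : ∀ k : 𝓢(Ed d, ℂ), ∀ x, 𝓕 (𝓕 k : 𝓢(Ed d, ℂ)) x = k (-x) := fun k x => by
      have := Real.fourierInv_eq_fourier_neg (𝓕 k : 𝓢(Ed d, ℂ)) (-x)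
      rw [neg_neg] at this
      rw [SchwartzMap.fourier_coe (𝓕 k : 𝓢(Ed d, ℂ)), ← this, ← SchwartzMap.fourierInv_coe,
        FourierTransform.fourierInv_fourier_eq]
    have hinj : ∀ k l : 𝓢(Ed d, ℂ), 𝓕 k = 𝓕 l → k = l := fun k l e => by
      simpa using congrArg (fun m : 𝓢(Ed d, ℂ) => (𝓕⁻ m : 𝓢(Ed d, ℂ))) e
    apply hinj
    ext x
    rw [SchwartzMap.fourier_convolution, SchwartzMap.pairing_apply_apply, hF, hF, hF,
      SchwartzMap.pairing_apply_apply]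
  rw [← h, SchwartzMap.convolution_apply]
  rfl

lemma integrable_mul_sub (f g : 𝓢(Ed d, ℂ)) (ξ : Ed d) :
    Integrable fun η => f η * g (ξ - η) := by
  refine f.integrable.mul_bdd (c := SchwartzMap.seminorm ℝ 0 0 g)
    (by fun_prop) (.of_forall fun η => SchwartzMap.norm_le_seminorm ℝ g _)

/-- The complex-valued coordinate of a Schwartz vector field. -/
def coordSchwartz (u : 𝓢(Ed d, Ed d)) (j : Fin d) : 𝓢(Ed d, ℂ) :=
  SchwartzMap.bilinLeftCLM
    ((ContinuousLinearMap.lsmul ℝ ℝ : ℝ →L[ℝ] ℂ →L[ℝ] ℂ).comp (EuclideanSpace.proj j))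
    (Function.HasTemperateGrowth.const (1 : ℂ)) u

lemma coordSchwartz_apply (u : 𝓢(Ed d, Ed d)) (j : Fin d) (x : Ed d) :
    coordSchwartz u j x = ((u x j : ℝ) : ℂ) := by
  simp [coordSchwartz, SchwartzMap.bilinLeftCLM_apply]

lemma fm_eq {a : Ed d → ℂ} (ha : a.HasTemperateGrowth) (f : 𝓢(Ed d, ℂ)) :
    fm a f = SchwartzMap.fourierMultiplierCLM ℂ a f := by
  rw [SchwartzMap.fourierMultiplierCLM_apply, SchwartzMap.fourierInv_coe, fm,
    SchwartzMap.smulLeftCLM_apply ha]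
  rfl

lemma fourier_fourierMultiplierCLM {a : Ed d → ℂ} (ha : a.HasTemperateGrowth) (f : 𝓢(Ed d, ℂ))
    (ξ : Ed d) : 𝓕 (SchwartzMap.fourierMultiplierCLM ℂ a f) ξ = a ξ * 𝓕 f ξ := by
  rw [SchwartzMap.fourierMultiplierCLM_apply, FourierTransform.fourier_fourierInv_eq,
    SchwartzMap.smulLeftCLM_apply_apply ha, smul_eq_mul]

lemma fourier_pd (j : Fin d) (f : 𝓢(Ed d, ℂ)) (ξ : Ed d) :
    𝓕 (∂_{(EuclideanSpace.single j 1 : Ed d)} f) ξ = 2 * Real.pi * I * ξ j * 𝓕 f ξ := by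
  rw [SchwartzMap.fourier_lineDerivOp_eq, smul_apply,
    SchwartzMap.smulLeftCLM_apply_apply (by fun_prop)]
  simp [EuclideanSpace.inner_single_right]
  ring

/-- The commutator `[∇ᵤ, a(D)] w` as a Schwartz function. -/
def commutatorSchwartz (a : Ed d → ℂ) (u : 𝓢(Ed d, Ed d)) (w : 𝓢(Ed d, ℂ)) : 𝓢(Ed d, ℂ) :=
  ∑ j, SchwartzMap.pairing (ContinuousLinearMap.mul ℂ ℂ)
      (∂_{(EuclideanSpace.single j 1 : Ed d)} (SchwartzMap.fourierMultiplierCLM ℂ a w))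
      (coordSchwartz u j) -
    SchwartzMap.fourierMultiplierCLM ℂ a (∑ j, SchwartzMap.pairing (ContinuousLinearMap.mul ℂ ℂ)
      (∂_{(EuclideanSpace.single j 1 : Ed d)} w) (coordSchwartz u j))

lemma coe_commutatorSchwartz {a : Ed d → ℂ} (ha : a.HasTemperateGrowth) (u : 𝓢(Ed d, Ed d))
    (w : 𝓢(Ed d, ℂ)) :
    (fun x => (∑ j : Fin d, ((u x j : ℝ) : ℂ) * pd j (fm a ⇑w) x)
      - fm a (fun y => ∑ j : Fin d, ((u y j : ℝ) : ℂ) * pd j (⇑w) y) x) =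
      commutatorSchwartz a u w := by
  have h : (fun y => ∑ j : Fin d, ((u y j : ℝ) : ℂ) * pd j (⇑w) y) =
      (∑ j, SchwartzMap.pairing (ContinuousLinearMap.mul ℂ ℂ)
        (∂_{(EuclideanSpace.single j 1 : Ed d)} w) (coordSchwartz u j) : 𝓢(Ed d, ℂ)) := by
    ext y
    simp [sum_apply, SchwartzMap.pairing_apply_apply, coordSchwartz_apply,
      SchwartzMap.lineDerivOp_apply_eq_fderiv, pd, mul_comm]
  rw [h, fm_eq ha, fm_eq ha]
  ext x
  simp only [commutatorSchwartz, sub_apply, sum_apply, SchwartzMap.pairing_apply_apply, coordSchwartz_apply,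
    SchwartzMap.lineDerivOp_apply_eq_fderiv, pd, ContinuousLinearMap.mul_apply', mul_comm]

lemma fourier_commutatorSchwartz {a : Ed d → ℂ} (ha : a.HasTemperateGrowth) (u : 𝓢(Ed d, Ed d))
    (w : 𝓢(Ed d, ℂ)) (ξ : Ed d) :
    𝓕 (commutatorSchwartz a u w) ξ = ∫ η, ∑ j, 2 * Real.pi * I * η j * (a η - a ξ) * 𝓕 w η *
      𝓕 (coordSchwartz u j) (ξ - η) := by
  have hi := fun j => integrable_mul_sub
    (𝓕 (∂_{(EuclideanSpace.single j 1 : Ed d)} (SchwartzMap.fourierMultiplierCLM ℂ a w)))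
    (𝓕 (coordSchwartz u j)) ξ
  have hi' := fun j => (integrable_mul_sub
    (𝓕 (∂_{(EuclideanSpace.single j 1 : Ed d)} w)) (𝓕 (coordSchwartz u j)) ξ).const_mul (a ξ)
  have hs : ∀ f : Fin d → 𝓢(Ed d, ℂ), 𝓕 (∑ j, f j) = ∑ j, 𝓕 (f j) := fun f =>
    map_sum (SchwartzMap.fourierTransformCLM ℂ) f _
  have hd : ∀ f g : 𝓢(Ed d, ℂ), 𝓕 (f - g) = 𝓕 f - 𝓕 g := fun f g =>
    map_sub (SchwartzMap.fourierTransformCLM ℂ) f g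
  rw [commutatorSchwartz, hd, sub_apply, fourier_fourierMultiplierCLM ha, hs, hs,
    sum_apply, sum_apply]
  simp_rw [fourier_pairing_mul]
  rw [Finset.mul_sum]
  simp_rw [← integral_const_mul]
  rw [← integral_finsetSum _ fun j _ => hi j, ← integral_finsetSum _ fun j _ => hi' j,
    ← integral_sub (integrable_finsetSum _ fun j _ => hi j)
      (integrable_finsetSum _ fun j _ => hi' j)]
  refine integral_congr_ae (.of_forall fun η => ?_)
  simp only [← Finset.sum_sub_distrib, fourier_pd, fourier_fourierMultiplierCLM ha]
  refine Finset.sum_congr rfl fun j _ => ?_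
  ring

lemma sq_sum_le_card_mul {ι : Type*} [Fintype ι] (x : ι → ℝ≥0∞) :
    (∑ j, x j) ^ 2 ≤ Fintype.card ι * ∑ j, x j ^ 2 := by
  have h := ENNReal.rpow_sum_le_const_mul_sum_rpow Finset.univ x (p := 2) (by norm_num)
  norm_num at h
  exact h

lemma lintegral_sq_sum_fourier_le (q : ℝ) (u : 𝓢(Ed d, Ed d)) :
    ∫⁻ ξ, (ENNReal.ofReal (jb q ξ) * ∑ j, ‖𝓕 (coordSchwartz u j) ξ‖ₑ) ^ 2 ≤
      d * ENNReal.ofReal (HNormV q u ^ 2) := by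
  have hV : HNormV q u ^ 2 = ∑ j, HNorm q (coordSchwartz u j) ^ 2 := by
    rw [HNormV, ← Real.sqrt_eq_rpow, Real.sq_sqrt (by positivity)]
    simp_rw [← coordSchwartz_apply]
  have hm := measurable_ofReal_jb (d := d) q
  have hc := fun j => (𝓕 (coordSchwartz u j)).continuous.measurable
  rw [hV, ENNReal.ofReal_sum_of_nonneg (fun _ _ => by positivity)]
  simp_rw [ofReal_HNorm_sq]
  rw [← lintegral_finsetSum _ (fun j _ => ?_), ← lintegral_const_mul _ ?_]
  · refine lintegral_mono fun ξ => ?_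
    rw [Finset.mul_sum]
    simpa using! sq_sum_le_card_mul fun j => ENNReal.ofReal (jb q ξ) * ‖𝓕 (coordSchwartz u j) ξ‖ₑ
  · exact Finset.measurable_sum _ fun j _ => (hm.mul (hc j).enorm).pow_const 2
  · exact (hm.mul (hc j).enorm).pow_const 2

lemma enorm_fourier_commutatorSchwartz_le {a : Ed d → ℂ} (ha : a.HasTemperateGrowth) {s q C : ℝ}
    (hC : 0 ≤ C) (hK : ∀ ξ η : Ed d, jb s ξ * (‖η‖ * ‖a η - a ξ‖) ≤
      C * (jb q (ξ - η) * jb 1 η + jb 1 (ξ - η) * jb q η))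
    (u : 𝓢(Ed d, Ed d)) (w : 𝓢(Ed d, ℂ)) (ξ : Ed d) :
    ENNReal.ofReal (jb s ξ) * ‖𝓕 (commutatorSchwartz a u w) ξ‖ₑ ≤
      ENNReal.ofReal (2 * Real.pi * C) *
        ∫⁻ η, ENNReal.ofReal (jb q (ξ - η) * jb 1 η + jb 1 (ξ - η) * jb q η) *
          ((∑ j, ‖𝓕 (coordSchwartz u j) (ξ - η)‖ₑ) * ‖𝓕 w η‖ₑ) := by
  rw [fourier_commutatorSchwartz ha, ← lintegral_const_mul' _ _ (by finiteness)]
  refine (mul_le_mul_right (enorm_integral_le_lintegral_enorm _) _).trans ?_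
  rw [← lintegral_const_mul' _ _ (by finiteness)]
  refine lintegral_mono fun η => ?_
  refine (mul_le_mul_right (enorm_sum_le _ _) _).trans ?_
  rw [Finset.sum_mul, Finset.mul_sum, Finset.mul_sum, Finset.mul_sum]
  refine Finset.sum_le_sum fun j _ => ?_
  rw [enorm_mul, enorm_mul, mul_comm ‖𝓕 (coordSchwartz u j) (ξ - η)‖ₑ, ← mul_assoc, ← mul_assoc,
    ← mul_assoc, ← mul_assoc]
  gcongr ?_ * _ * _
  rw [← ofReal_norm, ← ENNReal.ofReal_mul (jb_pos _ _).le, ← ENNReal.ofReal_mul (by positivity)]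
  refine ENNReal.ofReal_le_ofReal ?_
  have hj : ‖η j‖ ≤ ‖η‖ := PiLp.norm_apply_le η j
  calc jb s ξ * ‖2 * Real.pi * I * η j * (a η - a ξ)‖
      = 2 * Real.pi * (jb s ξ * (‖η j‖ * ‖a η - a ξ‖)) := by
        simp [abs_of_pos Real.pi_pos]
        ring
    _ ≤ 2 * Real.pi * (jb s ξ * (‖η‖ * ‖a η - a ξ‖)) := by
        have := jb_pos s ξ
        gcongr
    _ ≤ 2 * Real.pi * (C * (jb q (ξ - η) * jb 1 η + jb 1 (ξ - η) * jb q η)) :=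
        mul_le_mul_of_nonneg_left (hK ξ η) (by positivity)
    _ = _ := by ring

end Schwartz

/-- Boundedness of the first derivative `A₁(u) = [∇ᵤ, A]` of the twisted inertia operator:
for a symbol `a ∈ S^r` with `1 ≤ r ≤ q`, `q > 1 + d/2`,
`‖∇ᵤ(Aw) − A(∇ᵤw)‖_{H^{q-r}} ≤ C ‖u‖_{H^q} ‖w‖_{H^q}`. -/
theorem directional_commutator_bounded (d : ℕ) (hd : 1 ≤ d) (q r : ℝ)
    (hq : 1 + (d : ℝ) / 2 < q) (hr1 : 1 ≤ r) (hrq : r ≤ q)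
    (a : Ed d → ℂ) (ha : IsSymbolS r a) :
    ∃ C > 0, ∀ (u : SchwartzMap (Ed d) (Ed d)) (w : SchwartzMap (Ed d) ℂ),
      HNorm (q - r)
        (fun x => (∑ j : Fin d, ((u x j : ℝ) : ℂ) * pd j (fm a ⇑w) x)
          - fm a (fun y => ∑ j : Fin d, ((u y j : ℝ) : ℂ) * pd j (⇑w) y) x)
        ≤ C * HNormV q ⇑u * HNorm q ⇑w := by
  have hT := ha.hasTemperateGrowth
  obtain ⟨K, hK, hker⟩ := ha.kernel_bound hr1 hrq
  obtain ⟨M, hM, hconv⟩ := exists_lintegral_sq_weighted_convolution_le (d := d) hq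
  set N : ℝ := (2 * Real.pi * K) ^ 2 * (M.toReal * d) with hN
  have hN0 : 0 ≤ N := by positivity
  refine ⟨√(N + 1), Real.sqrt_pos.2 (by positivity), fun u w => ?_⟩
  rw [coe_commutatorSchwartz hT]
  have hV : 0 ≤ HNormV q u := Real.rpow_nonneg (Finset.sum_nonneg fun j _ => sq_nonneg _) _
  have hU : Measurable fun ζ => ∑ j, ‖𝓕 (coordSchwartz u j) ζ‖ₑ :=
    Finset.measurable_sum _ fun j _ => (𝓕 (coordSchwartz u j)).continuous.measurable.enorm
  have hW : Measurable fun ζ => ‖𝓕 w ζ‖ₑ := (𝓕 w).continuous.measurable.enorm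
  have key : ENNReal.ofReal (HNorm (q - r) (commutatorSchwartz a u w) ^ 2) ≤
      ENNReal.ofReal (N * (HNormV q u ^ 2 * HNorm q w ^ 2)) := by
    rw [ofReal_HNorm_sq]
    calc _ ≤ _ := lintegral_mono fun ξ => pow_le_pow_left'
          (enorm_fourier_commutatorSchwartz_le hT hK.le hker u w ξ) 2
      _ ≤ ENNReal.ofReal (2 * Real.pi * K) ^ 2 * (M * ((d * ENNReal.ofReal (HNormV q u ^ 2)) *
            ENNReal.ofReal (HNorm q w ^ 2))) := by
          simp_rw [mul_pow]
          rw [lintegral_const_mul' _ _ (by finiteness)]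
          gcongr
          refine (hconv _ _ hU hW).trans ?_
          rw [ofReal_HNorm_sq q w]
          gcongr
          · exact lintegral_sq_sum_fourier_le q u
          · rfl
      _ = _ := by
          rw [hN, ENNReal.ofReal_mul hN0, ENNReal.ofReal_mul (sq_nonneg (2 * Real.pi * K)),
            ENNReal.ofReal_mul M.toReal_nonneg, ENNReal.ofReal_mul (sq_nonneg (HNormV q u)),
            ENNReal.ofReal_pow (by positivity : 0 ≤ 2 * Real.pi * K), ENNReal.ofReal_toReal hM,
            ENNReal.ofReal_natCast]
          ring
  rw [ENNReal.ofReal_le_ofReal_iff (by positivity)] at key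
  refine le_of_sq_le_sq ?_ (mul_nonneg (mul_nonneg (Real.sqrt_nonneg _) hV) (HNorm_nonneg _ _))
  rw [mul_pow, mul_pow, Real.sq_sqrt (by positivity)]
  nlinarith [mul_nonneg (sq_nonneg (HNormV q u)) (sq_nonneg (HNorm q w))]
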